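/- Let s : [0,T] → [0,∞) be integrable and let y : [0,T] → E be absolutely continuous with ‖ẏ(t) − b(t,y(t))‖ ≤ s(t) for a.e. t ∈ [0,T]. Then for every τ ∈ [0,T], ‖κ(τ, y(τ)) − y(0)‖ ≤ ∫_0^τ e^{M(t)} s(t) dt. -/

import Mathlib

open MeasureTheory Set intervalIntegral

/-- Post-composing an absolutely continuous function with a Lipschitz map preserves absolute
continuity. -/
theorem LipschitzOnWith.comp_absolutelyContinuousOnInterval
    {X Y : Type*} [PseudoMetricSpace X] [PseudoMetricSpace Y] {f : ℝ → X} {g : X → Y}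
    {a b : ℝ} {S : Set X} {K : NNReal} (hg : LipschitzOnWith K g S)
    (hf : AbsolutelyContinuousOnInterval f a b) (hS : MapsTo f (uIcc a b) S) :
    AbsolutelyContinuousOnInterval (g ∘ f) a b := by
  rw [absolutelyContinuousOnInterval_iff] at hf ⊢
  intro ε hε
  obtain ⟨δ, hδ, h⟩ := hf (ε / (K + 1)) (by positivity)
  refine ⟨δ, hδ, fun I hI hlen ↦ ?_⟩
  have hsum := h I hI hlen
  calc
    _ ≤ ∑ i ∈ Finset.range I.1, K * dist (f (I.2 i).1) (f (I.2 i).2) :=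
      Finset.sum_le_sum fun i hi ↦
        hg.dist_le_mul _ (hS (hI.1 i hi).1) _ (hS (hI.1 i hi).2)
    _ = K * ∑ i ∈ Finset.range I.1, dist (f (I.2 i).1) (f (I.2 i).2) :=
      (Finset.mul_sum _ _ _).symm
    _ ≤ K * (ε / (K + 1)) := by gcongr
    _ < (K + 1) * (ε / (K + 1)) := by gcongr; linarith
    _ = ε := by field_simp

theorem AbsolutelyContinuousOnInterval.exp {f : ℝ → ℝ} {a b : ℝ}
    (hf : AbsolutelyContinuousOnInterval f a b) :
    AbsolutelyContinuousOnInterval (fun t ↦ Real.exp (f t)) a b := by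
  obtain ⟨C, hC⟩ := hf.exists_bound
  obtain ⟨K, hK⟩ := (Real.contDiff_exp (n := 1)).contDiffOn.exists_lipschitzOnWith
    (by decide) (convex_Icc (-C) C) isCompact_Icc
  exact hK.comp_absolutelyContinuousOnInterval hf fun t ht ↦ abs_le.1 (hC t ht)

/-- **Backward Grönwall inequality** in integral form, with integrable coefficients. -/
theorem le_integral_exp_mul_of_le_integral_backward {a τ : ℝ} (haτ : a ≤ τ) {L w σ : ℝ → ℝ}
    (hL0 : ∀ t, 0 ≤ L t) (hL : IntervalIntegrable L volume a τ)
    (hσ : IntervalIntegrable σ volume a τ) (hw : ContinuousOn w (uIcc a τ))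
    (h : ∀ t ∈ Icc a τ, w t ≤ ∫ s in t..τ, (L s * w s + σ s)) :
    w a ≤ ∫ t in a..τ, Real.exp (∫ s in a..t, L s) * σ t := by
  have hg : IntervalIntegrable (fun s ↦ L s * w s + σ s) volume a τ :=
    (hL.mul_continuousOn hw).add hσ
  have hu := hg.absolutelyContinuousOnInterval_intervalIntegral (c := τ) right_mem_uIcc
  have he := (hL.absolutelyContinuousOnInterval_intervalIntegral (c := a) left_mem_uIcc).exp
  have key := he.integral_deriv_mul_eq_sub hu
  simp only [integral_same, mul_zero, Real.exp_zero, one_mul, zero_sub] at key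
  rw [← integral_symm] at key
  refine (h a (left_mem_Icc.2 haτ)).trans (key.symm.trans_le ?_)
  refine integral_mono_ae_restrict haτ ?_ (hσ.continuousOn_mul he.continuousOn) ?_
  · exact (he.intervalIntegrable_deriv.mul_continuousOn hu.continuousOn).add
      (hu.intervalIntegrable_deriv.continuousOn_mul he.continuousOn)
  · rw [Filter.EventuallyLE, ae_restrict_iff' measurableSet_Icc]
    filter_upwards [hL.ae_hasDerivAt_integral, hg.ae_hasDerivAt_integral] with t hLt hgt ht
    have ht' : t ∈ uIcc a τ := Icc_subset_uIcc ht
    rw [(hLt ht' a left_mem_uIcc).exp.deriv, (hgt ht' τ right_mem_uIcc).deriv]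
    have hwt := h t ht
    rw [integral_symm] at hwt
    have := mul_le_mul_of_nonneg_left hwt
      (mul_nonneg (Real.exp_pos (∫ s in a..t, L s)).le (hL0 t))
    linarith

/-- Substituting a measurable function into a Carathéodory function is measurable. -/
theorem aestronglyMeasurable_comp_of_continuous_of_measurable {α E F : Type*} [MeasurableSpace α]
    [TopologicalSpace E] [TopologicalSpace.MetrizableSpace E] [SecondCountableTopology E]
    [MeasurableSpace E] [BorelSpace E]
    [TopologicalSpace F] [TopologicalSpace.PseudoMetrizableSpace F] [SecondCountableTopology F]
    [MeasurableSpace F] [BorelSpace F]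
    {μ : Measure α} {b : α → E → F} (hbmeas : ∀ y, Measurable fun t ↦ b t y)
    (hbcont : ∀ t, Continuous (b t)) {Y : α → E} (hY : AEMeasurable Y μ) :
    AEStronglyMeasurable (fun t ↦ b t (Y t)) μ := by
  have hb : Measurable (Function.uncurry fun y t ↦ b t y) :=
    measurable_uncurry_of_continuous_of_measurable hbcont hbmeas
  exact (hb.comp_aemeasurable (hY.prodMk aemeasurable_id)).aestronglyMeasurable

/-- **Drift estimate for the pull-back to time zero** (from the proof of
Proposition `dop`).  `E` is a finite-dimensional Euclidean space, `L` is
locally integrable and nonnegative, `M t = ∫_0^t L`, and `b` is measurable in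
`t`, continuous and `L(t)`-Lipschitz in `y`; all solutions of `ẏ = b(t,y)`
extend to `[0,∞)` (hypothesis `hbext`).  `κ(t*,y*)` is the value at time `0`
of the solution through `(t*,y*)` (hypothesis `hκ`).  If `y` is absolutely
continuous on `[0,T]` with `‖ẏ(t) − b(t,y(t))‖ ≤ σ(t)` a.e., then for every
`τ ∈ [0,T]`, `‖κ(τ, y(τ)) − y(0)‖ ≤ ∫_0^τ e^{M(t)} σ(t) dt`. -/
theorem pullback_drift_estimate
    {E : Type*} [NormedAddCommGroup E] [InnerProductSpace ℝ E]
    [FiniteDimensional ℝ E] [MeasurableSpace E] [BorelSpace E]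
    (L M : ℝ → ℝ) (hL0 : ∀ t, 0 ≤ L t)
    (hLint : ∀ T : ℝ, IntegrableOn L (Icc 0 T))
    (hM : ∀ t : ℝ, M t = ∫ s in (0:ℝ)..t, L s)
    (b : ℝ → E → E)
    (hbmeas : ∀ y : E, Measurable fun t => b t y)
    (hbcont : ∀ t : ℝ, Continuous fun y => b t y)
    (hblip : ∀ (t : ℝ) (y₁ y₂ : E), ‖b t y₁ - b t y₂‖ ≤ L t * ‖y₁ - y₂‖)
    (hbext : ∀ t₀ ≥ (0:ℝ), ∀ y₀ : E, ∃ Y : ℝ → E, ContinuousOn Y (Ici 0) ∧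
        Y t₀ = y₀ ∧ ∀ t ≥ (0:ℝ), Y t = y₀ + ∫ s in t₀..t, b s (Y s))
    (κ : ℝ → E → E)
    (hκ : ∀ tstar ≥ (0:ℝ), ∀ ystar : E, ∃ Y : ℝ → E,
        ContinuousOn Y (Ici 0) ∧ Y tstar = ystar ∧
        (∀ t ≥ (0:ℝ), Y t = ystar + ∫ s in tstar..t, b s (Y s)) ∧
        κ tstar ystar = Y 0)
    (T : ℝ) (hT : 0 ≤ T)
    (σ : ℝ → ℝ) (hσ0 : ∀ t, 0 ≤ σ t) (hσint : IntegrableOn σ (Icc 0 T))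
    (y : ℝ → E) (hyc : ContinuousOn y (Icc 0 T))
    (y' : ℝ → E) (hy'int : IntegrableOn y' (Icc 0 T))
    (hy : ∀ t ∈ Icc (0:ℝ) T, y t = y 0 + ∫ s in (0:ℝ)..t, y' s)
    (hdefect : ∀ᵐ t ∂(volume.restrict (Icc (0:ℝ) T)), ‖y' t - b t (y t)‖ ≤ σ t) :
    ∀ τ ∈ Icc (0:ℝ) T, ‖κ τ (y τ) - y 0‖ ≤ ∫ t in (0:ℝ)..τ, Real.exp (M t) * σ t := by
  intro τ hτ
  obtain ⟨Y, hYc, -, hYint, hκY⟩ := hκ τ hτ.1 (y τ)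
  rw [hκY]
  have hsub : Icc 0 τ ⊆ Icc 0 T := Icc_subset_Icc_right hτ.2
  have hτI : uIcc 0 τ = Icc 0 τ := uIcc_of_le hτ.1
  have hyτ : ContinuousOn y (uIcc 0 τ) := hτI ▸ hyc.mono hsub
  have hYτ : ContinuousOn Y (uIcc 0 τ) := hτI ▸ hYc.mono Icc_subset_Ici_self
  have hw : ContinuousOn (fun t ↦ ‖Y t - y t‖) (uIcc 0 τ) := (hYτ.sub hyτ).norm
  have hLτ : IntervalIntegrable L volume 0 τ :=
    (hτI ▸ hLint τ : IntegrableOn L (uIcc 0 τ)).intervalIntegrable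
  have hστ : IntervalIntegrable σ volume 0 τ :=
    (hτI ▸ hσint.mono_set hsub : IntegrableOn σ (uIcc 0 τ)).intervalIntegrable
  have hy'τ : IntervalIntegrable y' volume 0 τ :=
    (hτI ▸ hy'int.mono_set hsub : IntegrableOn y' (uIcc 0 τ)).intervalIntegrable
  have hgτ : IntervalIntegrable (fun t ↦ L t * ‖Y t - y t‖ + σ t) volume 0 τ :=
    (hLτ.mul_continuousOn hw).add hστ
  have hbound : ∀ᵐ t ∂volume.restrict (Icc 0 τ),
      ‖y' t - b t (Y t)‖ ≤ L t * ‖Y t - y t‖ + σ t := by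
    filter_upwards [ae_restrict_of_ae_restrict_of_subset hsub hdefect] with t ht
    calc
      _ ≤ ‖y' t - b t (y t)‖ + ‖b t (y t) - b t (Y t)‖ := norm_sub_le_norm_sub_add_norm_sub ..
      _ ≤ σ t + L t * ‖Y t - y t‖ := by
        rw [norm_sub_rev (Y t)]
        exact add_le_add ht (hblip t _ _)
      _ = _ := add_comm _ _
  have hbY : AEStronglyMeasurable (fun t ↦ b t (Y t)) (volume.restrict (Icc 0 τ)) :=
    aestronglyMeasurable_comp_of_continuous_of_measurable hbmeas hbcont
      ((hYc.mono Icc_subset_Ici_self).aemeasurable measurableSet_Icc)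
  -- The integral equation for `Y` is meaningful on `[0, τ]`: its integrand is integrable there.
  have hdiff : IntervalIntegrable (fun t ↦ y' t - b t (Y t)) volume 0 τ := by
    rw [intervalIntegrable_iff_integrableOn_Icc_of_le hτ.1] at hgτ ⊢
    exact Integrable.mono' hgτ ((hy'int.mono_set hsub).aestronglyMeasurable.sub hbY) hbound
  have hbYτ : IntervalIntegrable (fun t ↦ b t (Y t)) volume 0 τ := by
    simpa using hy'τ.sub hdiff
  simp_rw [hM]
  refine le_integral_exp_mul_of_le_integral_backward hτ.1 hL0 hLτ hστ hw fun t ht ↦ ?_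
  have htτ : uIcc t τ ⊆ uIcc 0 τ := uIcc_subset_uIcc_right (hτI ▸ ht)
  have h0t : uIcc 0 t ⊆ uIcc 0 τ := uIcc_subset_uIcc_left (hτI ▸ ht)
  have hrep : Y t - y t = ∫ s in t..τ, (y' s - b s (Y s)) := by
    rw [integral_sub (hy'τ.mono_set htτ) (hbYτ.mono_set htτ), hYint t ht.1, hy τ hτ,
      hy t (hsub ht), integral_symm t τ,
      ← integral_add_adjacent_intervals (hy'τ.mono_set h0t) (hy'τ.mono_set htτ)]
    abel
  rw [hrep]
  refine norm_integral_le_of_norm_le ht.2 ?_ (hgτ.mono_set htτ)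
  rw [ae_restrict_iff' measurableSet_Icc] at hbound
  filter_upwards [hbound] with s hs hst
  exact hs ⟨ht.1.trans hst.1.le, hst.2⟩
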